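/- There exists a constant c such that for all positive integers n and p there is a decision tree of basic height at most c·n/p that finds all p-runs in strings of length n (over an arbitrary linearly ordered alphabet). -/

import Mathlib

/-- `p` is a period of the substring `t[i..j]` of the 1-indexed string `t`:
`1 ≤ p ≤ |t[i..j]| = j - i + 1`, and `t[k] = t[k + p]` whenever both positions
lie in `[i..j]` (vacuously, the length is always a period). -/
def IsPeriodOf {α : Type*} (t : ℕ → α) (i j p : ℕ) : Prop :=
  1 ≤ p ∧ p ≤ j + 1 - i ∧ ∀ k, i ≤ k → k + p ≤ j → t (k + p) = t k

/-- The minimal period of the substring `t[i..j]`. -/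
noncomputable def minPeriod {α : Type*} (t : ℕ → α) (i j : ℕ) : ℕ :=
  sInf {p | IsPeriodOf t i j p}

/-- `t[i..j]` is a run of the string `t[1..n]`: its exponent is at least `2`
(i.e. `j - i + 1 ≥ 2 · minPeriod`), and the extensions `t[i-1..j]` (if `i > 1`)
and `t[i..j+1]` (if `j < n`) have strictly larger minimal periods. -/
def IsRun {α : Type*} (t : ℕ → α) (n i j : ℕ) : Prop :=
  1 ≤ i ∧ i ≤ j ∧ j ≤ n ∧
  2 * minPeriod t i j ≤ j + 1 - i ∧
  (1 < i → minPeriod t i j < minPeriod t (i - 1) j) ∧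
  (j < n → minPeriod t i j < minPeriod t i (j + 1))

/-- A decision tree processing strings of length `n`: every internal node is
labeled with a pair `(i, j)` of positions and has three children corresponding
to the outcomes `t[i] < t[j]`, `t[i] = t[j]`, `t[i] > t[j]`. -/
inductive DecisionTree : Type where
  | leaf : DecisionTree
  | node (i j : ℕ) (lt eq gt : DecisionTree) : DecisionTree

namespace DecisionTree

/-- All node labels `(i, j)` satisfy `1 ≤ i, j ≤ n`. -/
def WF (n : ℕ) : DecisionTree → Prop
  | .leaf => True
  | .node i j l e g => 1 ≤ i ∧ i ≤ n ∧ 1 ≤ j ∧ j ≤ n ∧ WF n l ∧ WF n e ∧ WF n g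

/-- The computation path of the string `t` through the tree, recorded as the
list of edge labels; it uniquely identifies the leaf reached by `t`
(two strings reach the same leaf iff their paths are equal). -/
def path {α : Type*} [LinearOrder α] : DecisionTree → (ℕ → α) → List Ordering
  | .leaf, _ => []
  | .node i j l e g, t =>
    if t i < t j then Ordering.lt :: path l t
    else if t i = t j then Ordering.eq :: path e t
    else Ordering.gt :: path g t

/-- The height of a decision tree: the maximum number of edges on a
root-to-leaf path. -/
def height : DecisionTree → ℕ
  | .leaf => 0
  | .node _ _ l e g => 1 + max (height l) (max (height e) (height g))

/-- The basic height of a decision tree: the maximum, over root-to-leaf paths,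
of the number of edges labeled `<` or `>`. -/
def basicHeight : DecisionTree → ℕ
  | .leaf => 0
  | .node _ _ l e g =>
    max (1 + max (basicHeight l) (basicHeight g)) (basicHeight e)

end DecisionTree

/-- `t[i..j]` is a `p`-run of `t[1..n]`: a run that is `q`-periodic (i.e. has
`q` as a period and length at least `2q`) for some multiple `q` of `p`. -/
def IsPRun {α : Type*} (t : ℕ → α) (n p i j : ℕ) : Prop :=
  IsRun t n i j ∧ ∃ q, p ∣ q ∧ 2 * q ≤ j + 1 - i ∧ IsPeriodOf t i j q

/-- The decision tree `T` finds all `p`-runs in strings of length `n`. -/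
def FindsAllPRuns (n p : ℕ) (T : DecisionTree) : Prop :=
  ∀ (α : Type) [LinearOrder α] (t₁ t₂ : ℕ → α),
    T.path t₁ = T.path t₂ → ∀ i j, (IsPRun t₁ n p i j ↔ IsPRun t₂ n p i j)

/-! ### Programs with results -/

/-- Decision trees whose leaves carry results. -/
inductive Prog (β : Type) : Type where
  | ret (b : β) : Prog β
  | query (i j : ℕ) (l e g : Prog β) : Prog β

namespace Prog

def toTree {β : Type} : Prog β → DecisionTree
  | .ret _ => .leaf
  | .query i j l e g => .node i j l.toTree e.toTree g.toTree

def run {β α : Type} [LinearOrder α] : Prog β → (ℕ → α) → β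
  | .ret b, _ => b
  | .query i j l e g, t =>
    if t i < t j then l.run t else if t i = t j then e.run t else g.run t

def bind {β γ : Type} : Prog β → (β → Prog γ) → Prog γ
  | .ret b, f => f b
  | .query i j l e g, f => .query i j (l.bind f) (e.bind f) (g.bind f)

/-- basic height with an additional cost `φ` at the leaves -/
def bh {β : Type} : Prog β → (β → ℕ) → ℕ
  | .ret b, φ => φ b
  | .query _ _ l e g, φ => max (1 + max (l.bh φ) (g.bh φ)) (e.bh φ)

def Ok {β : Type} (n : ℕ) : Prog β → Prop
  | .ret _ => True
  | .query i j l e g => 1 ≤ i ∧ i ≤ n ∧ 1 ≤ j ∧ j ≤ n ∧ Ok n l ∧ Ok n e ∧ Ok n g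

theorem run_of_path {β α : Type} [LinearOrder α] (P : Prog β) (t₁ t₂ : ℕ → α)
    (h : P.toTree.path t₁ = P.toTree.path t₂) : P.run t₁ = P.run t₂ := by
  induction P with
  | ret b => rfl
  | query i j l e g ihl ihe ihg =>
    simp only [toTree, DecisionTree.path, run] at h ⊢
    split_ifs at h ⊢ <;> simp_all

theorem run_bind {β γ α : Type} [LinearOrder α] (P : Prog β) (f : β → Prog γ) (t : ℕ → α) :
    (P.bind f).run t = (f (P.run t)).run t := by
  induction P with
  | ret b => rfl
  | query i j l e g ihl ihe ihg =>
    simp only [bind, run, ihl, ihe, ihg]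
    split_ifs <;> rfl

theorem bh_bind {β γ : Type} (P : Prog β) (f : β → Prog γ) (φ : γ → ℕ) :
    (P.bind f).bh φ = P.bh (fun b => (f b).bh φ) := by
  induction P with
  | ret b => rfl
  | query i j l e g ihl ihe ihg => simp only [bind, bh, ihl, ihe, ihg]

theorem bh_mono {β : Type} (P : Prog β) {φ ψ : β → ℕ} (h : ∀ b, φ b ≤ ψ b) :
    P.bh φ ≤ P.bh ψ := by
  induction P with
  | ret b => exact h b
  | query i j l e g ihl ihe ihg => simp only [bh]; omega

theorem basicHeight_toTree {β : Type} (P : Prog β) :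
    P.toTree.basicHeight = P.bh (fun _ => 0) := by
  induction P with
  | ret b => rfl
  | query i j l e g ihl ihe ihg => simp only [toTree, DecisionTree.basicHeight, bh, ihl, ihe, ihg]

theorem wf_toTree {β : Type} (n : ℕ) (P : Prog β) (h : P.Ok n) : P.toTree.WF n := by
  induction P with
  | ret b => trivial
  | query i j l e g ihl ihe ihg =>
    obtain ⟨h1, h2, h3, h4, h5, h6, h7⟩ := h
    exact ⟨h1, h2, h3, h4, ihl h5, ihe h6, ihg h7⟩

/-- postcondition: every leaf result satisfies `Q`. -/
def Post {β : Type} (Q : β → Prop) : Prog β → Prop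
  | .ret b => Q b
  | .query _ _ l e g => Post Q l ∧ Post Q e ∧ Post Q g

theorem ok_bind {β γ : Type} (n : ℕ) (Q : β → Prop) (P : Prog β) (f : β → Prog γ)
    (h : P.Ok n) (hQ : P.Post Q) (hf : ∀ b, Q b → (f b).Ok n) : (P.bind f).Ok n := by
  induction P with
  | ret b => exact hf b hQ
  | query i j l e g ihl ihe ihg =>
    obtain ⟨h1, h2, h3, h4, h5, h6, h7⟩ := h
    exact ⟨h1, h2, h3, h4, ihl h5 hQ.1, ihe h6 hQ.2.1, ihg h7 hQ.2.2⟩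

theorem post_true {β : Type} (P : Prog β) : P.Post (fun _ => True) := by
  induction P with
  | ret b => trivial
  | query i j l e g ihl ihe ihg => exact ⟨ihl, ihe, ihg⟩

theorem post_bind {β γ : Type} (Q : γ → Prop) (P : Prog β) (f : β → Prog γ)
    (hf : ∀ b, (f b).Post Q) : (P.bind f).Post Q := by
  induction P with
  | ret b => exact hf b
  | query i j l e g ihl ihe ihg => exact ⟨ihl, ihe, ihg⟩

end Prog

open Prog

/-- match `f x` against `g x` for `x, x+1, ...` -/
def mtch (f g : ℕ → ℕ) : ℕ → ℕ → Prog (ℕ × Ordering)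
  | 0, x => .ret (x, .gt)
  | k + 1, x => .query (f x) (g x) (.ret (x, .lt)) (mtch f g k (x + 1)) (.ret (x, .gt))

theorem mtch_bh (f g : ℕ → ℕ) (k x : ℕ) (φ : ℕ × Ordering → ℕ) (C : ℕ) (h : ∀ r, φ r ≤ C) :
    (mtch f g k x).bh φ ≤ C + 1 := by
  induction k generalizing x with
  | zero => exact (h _).trans (by omega)
  | succ k ih =>
    have h1 := h (x, .lt)
    have h2 := h (x, .gt)
    have h3 := ih (x + 1)
    simp only [mtch, bh]
    omega

theorem mtch_ok (n : ℕ) (f g : ℕ → ℕ) (k x : ℕ)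
    (h : ∀ y, x ≤ y → y < x + k → 1 ≤ f y ∧ f y ≤ n ∧ 1 ≤ g y ∧ g y ≤ n) :
    (mtch f g k x).Ok n := by
  induction k generalizing x with
  | zero => trivial
  | succ k ih =>
    obtain ⟨h1, h2, h3, h4⟩ := h x le_rfl (by omega)
    exact ⟨h1, h2, h3, h4, trivial, ih (x + 1) (fun y hy hy' => h y (by omega) (by omega)), trivial⟩

theorem mtch_spec {α : Type} [LinearOrder α] (t : ℕ → α) (f g : ℕ → ℕ) (k x : ℕ) :
    ∃ r o, (mtch f g k x).run t = (r, o) ∧ x ≤ r ∧ r ≤ x + k ∧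
      (∀ y, x ≤ y → y < r → t (f y) = t (g y)) ∧
      ((r = x + k ∧ o = .gt) ∨ (r < x + k ∧ o = .lt ∧ t (f r) < t (g r)) ∨
        (r < x + k ∧ o = .gt ∧ t (g r) < t (f r))) := by
  induction k generalizing x with
  | zero => exact ⟨x, .gt, rfl, le_rfl, le_rfl, fun y h1 h2 => by omega, Or.inl ⟨rfl, rfl⟩⟩
  | succ k ih =>
    simp only [mtch, run]
    split_ifs with h1 h2
    · exact ⟨x, .lt, rfl, le_rfl, by omega, fun y h1 h2 => by omega,
        Or.inr (Or.inl ⟨by omega, rfl, h1⟩)⟩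
    · obtain ⟨r, o, e, a1, a2, a3, a4⟩ := ih (x + 1)
      refine ⟨r, o, e, by omega, by omega, fun y hy hy' => ?_, ?_⟩
      · rcases Nat.eq_or_lt_of_le hy with rfl | h
        · exact h2
        · exact a3 y h hy'
      · rwa [show x + (k + 1) = x + 1 + k by omega]
    · exact ⟨x, .gt, rfl, le_rfl, by omega, fun y h1 h2 => by omega,
        Or.inr (Or.inr ⟨by omega, rfl, lt_of_le_of_ne (not_lt.mp h1) (Ne.symm h2)⟩)⟩

/-- Pop the stack until a strictly smaller suffix is found. -/
def scan (n p : ℕ) (o : Ordering) (a : ℕ) : List ℕ → Prog (List ℕ)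
  | [] => .ret []
  | b :: s => (mtch (fun x => a * p + x) (fun x => b * p + x) (n + 1 - b * p) 0).bind fun r =>
      if r.2 = o then .ret (b :: s) else scan n p o a s

/-- Extend the period given by the pair `(a, head of the stack)`. -/
def ext (n p : ℕ) (a : ℕ) : List ℕ → Prog (List (ℕ × ℕ × ℕ))
  | [] => .ret []
  | b :: _ =>
    (mtch (fun x => a * p - 1 - x) (fun x => b * p - 1 - x) (a * p - 1) 0).bind fun l =>
    (mtch (fun x => a * p + x) (fun x => b * p + x) (n + 1 - b * p) 0).bind fun r =>
      .ret [(a * p - l.1, b * p + r.1 - 1, (b - a) * p)]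

def loop (n p : ℕ) (o : Ordering) : ℕ → List ℕ → Prog (List (ℕ × ℕ × ℕ))
  | 0, _ => .ret []
  | a + 1, s => (scan n p o (a + 1) s).bind fun s' =>
      (ext n p (a + 1) s').bind fun r =>
      (loop n p o a ((a + 1) :: s')).bind fun rest => .ret (r ++ rest)

def whole (n p : ℕ) : Prog (List (ℕ × ℕ × ℕ)) :=
  (loop n p .gt (n / p) []).bind fun r₁ =>
    (loop n p .lt (n / p) []).bind fun r₂ => .ret (r₁ ++ r₂)

theorem scan_bh (n p : ℕ) (o : Ordering) (a : ℕ) (s : List ℕ) (φ : List ℕ → ℕ) (C : ℕ)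
    (h : ∀ s', φ s' ≤ s'.length + C) : (scan n p o a s).bh φ ≤ s.length + C + 1 := by
  induction s with
  | nil => exact (h []).trans (by simp)
  | cons b s ih =>
    simp only [scan, bh_bind]
    refine (mtch_bh _ _ _ _ _ (s.length + C + 1) fun r => ?_).trans (by simp only [List.length_cons]; omega)
    split_ifs
    · exact (h _).trans (by simp only [List.length_cons]; omega)
    · exact ih

theorem ext_bh (n p : ℕ) (a : ℕ) (s : List ℕ) (φ : List (ℕ × ℕ × ℕ) → ℕ) (C : ℕ)
    (h : ∀ s', φ s' ≤ C) : (ext n p a s).bh φ ≤ C + 2 := by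
  cases s with
  | nil => exact (h []).trans (by simp)
  | cons b s =>
    simp only [ext, bh_bind]
    refine mtch_bh _ _ _ _ _ (C + 1) fun r => ?_
    refine mtch_bh _ _ _ _ _ C fun r => ?_
    exact h _

theorem loop_bh (n p : ℕ) (o : Ordering) (a : ℕ) (s : List ℕ) (φ : List (ℕ × ℕ × ℕ) → ℕ) (C : ℕ)
    (h : ∀ s', φ s' ≤ C) : (loop n p o a s).bh φ ≤ 4 * a + s.length + C := by
  induction a generalizing s φ with
  | zero => exact (h []).trans (by simp)
  | succ a ih =>
    simp only [loop, bh_bind]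
    refine (scan_bh _ _ _ _ _ _ (4 * a + C + 3) fun s' => ?_).trans (by omega)
    refine (ext_bh _ _ _ _ _ (4 * a + (s'.length + 1) + C) fun r => ?_).trans (by omega)
    exact ih _ _ (fun s'' => h _)

theorem whole_bh (n p : ℕ) : (whole n p).bh (fun _ => 0) ≤ 8 * (n / p) := by
  simp only [whole, bh_bind]
  refine (loop_bh _ _ _ _ _ _ (4 * (n / p)) fun r => ?_).trans (by simp; omega)
  exact (loop_bh _ _ _ _ _ _ 0 fun r => le_rfl).trans (by simp)

theorem scan_ok (n p : ℕ) (hp : 0 < p) (o : Ordering) (a : ℕ) (ha : 1 ≤ a) (s : List ℕ)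
    (h : ∀ b ∈ s, a < b) : (scan n p o a s).Ok n := by
  induction s with
  | nil => trivial
  | cons b s ih =>
    simp only [scan]
    have hab : a * p < b * p := Nat.mul_lt_mul_of_pos_right (h b (by simp)) hp
    have ha' : 1 ≤ a * p := Nat.mul_pos ha hp
    refine ok_bind n (fun _ => True) _ _ (mtch_ok _ _ _ _ _ fun y _ hy => ?_) (post_true _)
      fun r _ => ?_
    · omega
    · split_ifs
      · trivial
      · exact ih fun b hb => h b (by simp [hb])

theorem scan_post (n p : ℕ) (o : Ordering) (a : ℕ) (s : List ℕ) :
    (scan n p o a s).Post (fun s' => s' <:+ s) := by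
  induction s with
  | nil => exact List.suffix_rfl
  | cons b s ih =>
    simp only [scan]
    refine post_bind _ _ _ fun r => ?_
    split_ifs
    · exact List.suffix_rfl
    · have : ∀ P : Prog (List ℕ), P.Post (fun s' => s' <:+ s) →
          P.Post (fun s' => s' <:+ b :: s) := by
        intro P hP
        induction P with
        | ret b => exact List.IsSuffix.trans hP (List.suffix_cons _ _)
        | query i j l e g ihl ihe ihg => exact ⟨ihl hP.1, ihe hP.2.1, ihg hP.2.2⟩
      exact this _ ih

theorem ext_ok (n p : ℕ) (hp : 0 < p) (a : ℕ) (ha : 1 ≤ a) (s : List ℕ)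
    (h : ∀ b ∈ s, a < b ∧ b * p ≤ n) : (ext n p a s).Ok n := by
  cases s with
  | nil => trivial
  | cons b s =>
    have hb := (h b (by simp)).2
    have hab : a * p < b * p := Nat.mul_lt_mul_of_pos_right (h b (by simp)).1 hp
    have ha' : 1 ≤ a * p := Nat.mul_pos ha hp
    simp only [ext]
    refine ok_bind n (fun _ => True) _ _ (mtch_ok _ _ _ _ _ fun y _ hy => ?_) (post_true _)
      fun r _ => ?_
    · omega
    refine ok_bind n (fun _ => True) _ _ (mtch_ok _ _ _ _ _ fun y _ hy => ?_) (post_true _)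
      fun r _ => trivial
    omega

theorem loop_ok (n p : ℕ) (hp : 0 < p) (o : Ordering) (a : ℕ) (s : List ℕ)
    (han : a * p ≤ n) (h : ∀ b ∈ s, a < b ∧ b * p ≤ n) : (loop n p o a s).Ok n := by
  induction a generalizing s with
  | zero => trivial
  | succ a ih =>
    simp only [loop]
    refine ok_bind n _ _ _ (scan_ok n p hp o _ (by omega) s fun b hb => (h b hb).1)
      (scan_post _ _ _ _ _) fun s' hs' => ?_
    refine ok_bind n _ _ _ (ext_ok n p hp _ (by omega) s' fun b hb => h b (hs'.subset hb))
      (post_true _) fun r _ => ?_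
    refine ok_bind n _ _ _ (ih _ ?_ ?_) (post_true _) fun r _ => trivial
    · exact (Nat.mul_le_mul_right p (by omega)).trans han
    · intro b hb
      rcases List.mem_cons.mp hb with rfl | hb
      · exact ⟨by omega, han⟩
      · have := h b (hs'.subset hb)
        exact ⟨by omega, this.2⟩

theorem whole_ok (n p : ℕ) (hp : 0 < p) : (whole n p).Ok n := by
  have hm := Nat.div_mul_le_self n p
  refine ok_bind n _ _ _ (loop_ok n p hp _ _ _ hm (by simp)) (post_true _) fun r _ => ?_
  exact ok_bind n _ _ _ (loop_ok n p hp _ _ _ hm (by simp)) (post_true _) fun r _ => trivial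

/-! ### Correctness of the program -/

/-- `[i..j]` is a maximal interval of `[1..n]` with shift `q`. -/
def MaxPer {α : Type} (t : ℕ → α) (n q i j : ℕ) : Prop :=
  1 ≤ i ∧ j ≤ n ∧ (∀ k, i ≤ k → k + q ≤ j → t (k + q) = t k) ∧
  (1 < i → t (i - 1 + q) ≠ t (i - 1)) ∧ (j < n → t (j + 1) ≠ t (j + 1 - q))

def IsNSS {L : Type} [LinearOrder L] (K : ℕ → L) (a b : ℕ) : Prop :=
  a < b ∧ K b < K a ∧ ∀ c, a < c → c < b → K a ≤ K c

theorem ext_spec {α : Type} [LinearOrder α] (t : ℕ → α) (n p a b : ℕ) (s : List ℕ) (hp : 0 < p)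
    (ha : 1 ≤ a) (hab : a < b) (hb : b * p ≤ n) :
    ∃ i j, (ext n p a (b :: s)).run t = [(i, j, (b - a) * p)] ∧ MaxPer t n ((b - a) * p) i j ∧
      i ≤ a * p ∧ a * p + (b - a) * p ≤ j + 1 := by
  have hab' : a * p < b * p := Nat.mul_lt_mul_of_pos_right hab hp
  have ha' : 1 ≤ a * p := Nat.mul_pos ha hp
  have hq : (b - a) * p = b * p - a * p := Nat.sub_mul _ _ _
  simp only [ext, run_bind]
  obtain ⟨l, o₁, e₁, -, hl, l1, l2⟩ := mtch_spec t (fun x => a * p - 1 - x)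
    (fun x => b * p - 1 - x) (a * p - 1) 0
  obtain ⟨r, o₂, e₂, -, hr, r1, r2⟩ := mtch_spec t (fun x => a * p + x)
    (fun x => b * p + x) (n + 1 - b * p) 0
  rw [e₁, e₂, hq]
  generalize a * p = A at *
  generalize b * p = B at *
  refine ⟨_, _, rfl, ⟨?_, ?_, ?_, ?_, ?_⟩, ?_, ?_⟩ <;> dsimp only
  · omega
  · omega
  · intro k hk hk'
    by_cases h : k < A
    · have := l1 (A - 1 - k) (by omega) (by omega)
      rw [show A - 1 - (A - 1 - k) = k by omega,
        show B - 1 - (A - 1 - k) = k + (B - A) by omega] at this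
      exact this.symm
    · have := r1 (k - A) (by omega) (by omega)
      rw [show A + (k - A) = k by omega, show B + (k - A) = k + (B - A) by omega] at this
      exact this.symm
  · intro h
    rw [show A - l - 1 + (B - A) = B - 1 - l by omega, show A - l - 1 = A - 1 - l by omega]
    rcases l2 with h' | h' | h'
    · omega
    · exact h'.2.2.ne'
    · exact h'.2.2.ne
  · intro h
    rw [show B + r - 1 + 1 - (B - A) = A + r by omega, show B + r - 1 + 1 = B + r by omega]
    rcases r2 with h' | h' | h'
    · omega
    · exact h'.2.2.ne'
    · exact h'.2.2.ne
  · omega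
  · omega

theorem scan_spec {α L : Type} [LinearOrder α] [LinearOrder L] (t : ℕ → α) (n p m : ℕ)
    (o : Ordering) (K : ℕ → L)
    (hK : ∀ a b, 1 ≤ a → a < b → b ≤ m →
      (((mtch (fun x => a * p + x) (fun x => b * p + x) (n + 1 - b * p) 0).run t).2 = o ↔ K b < K a))
    (a : ℕ) (ha : 1 ≤ a) (s : List ℕ) (hs : ∀ b ∈ s, a < b ∧ b ≤ m) :
    ∃ pre, s = pre ++ (scan n p o a s).run t ∧ (∀ b ∈ pre, K a ≤ K b) ∧
      ∀ b, ((scan n p o a s).run t).head? = some b → K b < K a := by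
  induction s with
  | nil => exact ⟨[], rfl, by simp, by simp [scan, run]⟩
  | cons b s ih =>
    have hb := hs b (by simp)
    have := hK a b ha hb.1 hb.2
    simp only [scan, run_bind]
    split_ifs with h
    · refine ⟨[], rfl, by simp, ?_⟩
      intro c hc
      simp only [run, List.head?_cons, Option.some.injEq] at hc
      subst hc
      exact this.mp h
    · obtain ⟨pre, e, h1, h2⟩ := ih fun c hc => hs c (by simp [hc])
      refine ⟨b :: pre, ?_, ?_, h2⟩
      · rw [List.cons_append, ← e]
      · intro c hc
        rcases List.mem_cons.mp hc with rfl | hc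
        · exact not_lt.mp fun h' => h (this.mpr h')
        · exact h1 c hc

theorem loop_spec {α L : Type} [LinearOrder α] [LinearOrder L] (t : ℕ → α) (n p m : ℕ)
    (hp : 0 < p) (hm : m * p ≤ n) (o : Ordering) (K : ℕ → L)
    (hK : ∀ a b, 1 ≤ a → a < b → b ≤ m →
      (((mtch (fun x => a * p + x) (fun x => b * p + x) (n + 1 - b * p) 0).run t).2 = o ↔ K b < K a))
    (a : ℕ) (ham : a ≤ m) (s : List ℕ) (hs : ∀ b ∈ s, a < b ∧ b ≤ m) (hs' : s.Pairwise (· < ·))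
    (inv : ∀ c, a < c → c ≤ m → ∃ b ∈ s, b ≤ c ∧ K b ≤ K c) :
    (∀ x ∈ (loop n p o a s).run t, MaxPer t n x.2.2 x.1 x.2.1 ∧ 1 ≤ x.2.2 ∧ p ∣ x.2.2) ∧
    (∀ a' b', 1 ≤ a' → a' ≤ a → b' ≤ m → IsNSS K a' b' → ∃ i j,
      (i, j, (b' - a') * p) ∈ (loop n p o a s).run t ∧ MaxPer t n ((b' - a') * p) i j ∧
      i ≤ a' * p ∧ a' * p + (b' - a') * p ≤ j + 1) := by
  induction a generalizing s with
  | zero =>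
    refine ⟨by simp [loop, run], fun a' b' h1 h2 => by omega⟩
  | succ a ih =>
    obtain ⟨pre, e, h1, h2⟩ := scan_spec t n p m o K hK (a + 1) (by omega) s hs
    simp only [loop, run_bind]
    generalize (scan n p o (a + 1) s).run t = s' at *
    have hsub : ∀ b ∈ s', b ∈ s := fun b hb => by rw [e]; simp [hb]
    have hpw : s'.Pairwise (· < ·) := by
      rw [e] at hs'
      exact (List.pairwise_append.mp hs').2.1
    obtain ⟨i1, i2⟩ := ih (by omega) ((a + 1) :: s') (by
        intro b hb
        rcases List.mem_cons.mp hb with rfl | hb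
        · omega
        · have := hs b (hsub b hb)
          omega) (by
        refine List.pairwise_cons.mpr ⟨fun b hb => (hs b (hsub b hb)).1, hpw⟩) (by
        intro c hc hcm
        rcases Nat.eq_or_lt_of_le hc with rfl | hc
        · exact ⟨a + 1, by simp, le_rfl, le_rfl⟩
        · obtain ⟨b, hb, hbc, hKb⟩ := inv c hc hcm
          rw [e] at hb
          rcases List.mem_append.mp hb with hb | hb
          · exact ⟨a + 1, by simp, by omega, (h1 b hb).trans hKb⟩
          · exact ⟨b, by simp [hb], hbc, hKb⟩)
    simp only [run, List.mem_append]
    constructor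
    · rintro x (hx | hx)
      · cases s' with
        | nil => simp [ext, run] at hx
        | cons b s'' =>
          have hb := hs b (hsub b (by simp))
          obtain ⟨i, j, e', m1, -, -⟩ := ext_spec t n p (a + 1) b s'' hp (by omega) hb.1
            ((Nat.mul_le_mul_right p hb.2).trans hm)
          rw [e', List.mem_singleton] at hx
          subst hx
          exact ⟨m1, Nat.mul_pos (by omega) hp, Dvd.intro_left _ rfl⟩
      · exact i1 x hx
    · intro a' b' ha' haa hb' hN
      rcases Nat.eq_or_lt_of_le haa with rfl | haa
      · obtain ⟨n1, n2, n3⟩ := hN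
        obtain ⟨b, hb, hbc, hKb⟩ := inv b' n1 hb'
        have hbb : b = b' := by
          rcases Nat.eq_or_lt_of_le hbc with h | h
          · exact h
          · exact absurd (n3 b (hs b hb).1 h) (not_le.mpr (hKb.trans_lt n2))
        subst hbb
        have hbs : b ∈ s' := by
          rw [e] at hb
          rcases List.mem_append.mp hb with hb | hb
          · exact absurd (h1 b hb) (not_le.mpr n2)
          · exact hb
        cases s' with
        | nil => simp at hbs
        | cons c s'' =>
          have hcb : c = b := by
            rcases List.mem_cons.mp hbs with h | h
            · exact h.symm
            · have hlt := (List.pairwise_cons.mp hpw).1 b h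
              exact absurd (n3 c (hs c (hsub c (by simp))).1 hlt) (not_le.mpr (h2 c rfl))
          subst hcb
          obtain ⟨i, j, e', m1, m2, m3⟩ := ext_spec t n p (a + 1) c s'' hp (by omega) n1
            ((Nat.mul_le_mul_right p hb').trans hm)
          exact ⟨i, j, Or.inl (by rw [e']; simp), m1, m2, m3⟩
      · obtain ⟨i, j, h, hrest⟩ := i2 a' b' ha' (by omega) hb' hN
        exact ⟨i, j, Or.inr h, hrest⟩

/-! ### Lexicographic comparison of suffixes -/

def LexKey (β : Type) : Type := Lex (ℕ → β)

noncomputable instance {β : Type} [LinearOrder β] : LinearOrder (LexKey β) :=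
  inferInstanceAs (LinearOrder (Lex (ℕ → β)))

def key {β : Type} (u : ℕ → β) (p a : ℕ) : LexKey β := toLex (fun x => u (a * p + x))

theorem key_lt {β : Type} [LinearOrder β] (u : ℕ → β) (p a b : ℕ) :
    key u p a < key u p b ↔
      ∃ l, (∀ x, x < l → u (a * p + x) = u (b * p + x)) ∧ u (a * p + l) < u (b * p + l) :=
  Iff.rfl

def pad {α : Type} (n : ℕ) (t : ℕ → α) (x : ℕ) : WithBot α := if x ≤ n then (t x : WithBot α) else ⊥

theorem cmp_spec {α : Type} [LinearOrder α] (t : ℕ → α) (n p a b : ℕ) (hp : 0 < p)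
    (hab : a < b) (hb : b * p ≤ n) :
    (((mtch (fun x => a * p + x) (fun x => b * p + x) (n + 1 - b * p) 0).run t).2 = .gt ∧
      key (pad n t) p b < key (pad n t) p a) ∨
    (((mtch (fun x => a * p + x) (fun x => b * p + x) (n + 1 - b * p) 0).run t).2 = .lt ∧
      key (pad n t) p a < key (pad n t) p b) := by
  obtain ⟨r, o, e, -, hr, r1, r2⟩ := mtch_spec t (fun x => a * p + x)
    (fun x => b * p + x) (n + 1 - b * p) 0
  have hab' : a * p < b * p := Nat.mul_lt_mul_of_pos_right hab hp
  rw [e, key_lt, key_lt]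
  generalize a * p = A at *
  generalize b * p = B at *
  dsimp only at *
  have hag : ∀ x, x < r → pad n t (A + x) = pad n t (B + x) := by
    intro x hx
    simp only [pad]
    rw [if_pos (by omega), if_pos (by omega), r1 x (by omega) hx]
  rcases r2 with ⟨h1, h2⟩ | ⟨h1, h2, h3⟩ | ⟨h1, h2, h3⟩
  · refine Or.inl ⟨h2, r, fun x hx => (hag x hx).symm, ?_⟩
    simp only [pad]
    rw [if_neg (by omega), if_pos (by omega)]
    exact WithBot.bot_lt_coe _
  · refine Or.inr ⟨h2, r, hag, ?_⟩
    simp only [pad]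
    rw [if_pos (by omega), if_pos (by omega)]
    exact WithBot.coe_lt_coe.mpr h3
  · refine Or.inl ⟨h2, r, fun x hx => (hag x hx).symm, ?_⟩
    simp only [pad]
    rw [if_pos (by omega), if_pos (by omega)]
    exact WithBot.coe_lt_coe.mpr h3

theorem key_dual {β : Type} [LinearOrder β] (u : ℕ → β) (p a b : ℕ) :
    key (fun x => OrderDual.toDual (u x)) p b < key (fun x => OrderDual.toDual (u x)) p a ↔
      key u p a < key u p b := by
  rw [key_lt, key_lt]
  simp only [OrderDual.toDual_lt_toDual, OrderDual.toDual_inj]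
  constructor
  · rintro ⟨l, h1, h2⟩
    exact ⟨l, fun x hx => (h1 x hx).symm, h2⟩
  · rintro ⟨l, h1, h2⟩
    exact ⟨l, fun x hx => (h1 x hx).symm, h2⟩

/-! ### Every `p`-run yields a next-smaller-suffix pair -/

theorem exists_nss {β : Type} [LinearOrder β] (u : ℕ → β) (p k i j : ℕ) (hp : 0 < p) (hk : 0 < k)
    (hi : 1 ≤ i) (hlen : i + 2 * (k * p) ≤ j + 1)
    (hper : ∀ y, i ≤ y → y + k * p ≤ j → u (y + k * p) = u y)
    (hlt : u (j + 1) < u (j + 1 - k * p))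
    (hmin : ∀ d, 0 < d → d < k → ¬ ∀ y, i ≤ y → y + d * p ≤ j → u (y + d * p) = u y) :
    ∃ a, 1 ≤ a ∧ i ≤ a * p ∧ a * p + k * p ≤ j ∧ IsNSS (key u p) a (a + k) := by
  have hq : 0 < k * p := Nat.mul_pos hk hp
  set q := k * p with hqdef
  set w : ℕ → β := fun y => u (i + (y - i) % q) with hw
  have w1 : ∀ y, i ≤ y → w (y + q) = w y := by
    intro y hy
    simp only [hw]
    rw [show y + q - i = (y - i) + q by omega, Nat.add_mod_right]
  have w2 : ∀ y, i ≤ y → y ≤ j → w y = u y := by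
    intro y
    induction y using Nat.strong_induction_on with
    | _ y ih =>
      intro h1 h2
      by_cases h : y < i + q
      · simp only [hw]
        rw [Nat.mod_eq_of_lt (by omega), Nat.add_sub_cancel' h1]
      · have h3 := ih (y - q) (by omega) (by omega) (by omega)
        have h4 := w1 (y - q) (by omega)
        have h5 := hper (y - q) (by omega) (by omega)
        rw [Nat.sub_add_cancel (by omega)] at h4 h5
        rw [h4, h3, h5]
  have w3 : ∀ N y, i ≤ y → w (y + N * q) = w y := by
    intro N y hy
    induction N with
    | zero => simp
    | succ N ih => rw [Nat.succ_mul, ← Nat.add_assoc, w1 _ (by omega), ih]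
  -- first block start
  obtain ⟨a₀, ha₀, ha₀'⟩ : ∃ a₀, i ≤ a₀ * p ∧ a₀ * p + 1 ≤ i + p := by
    refine ⟨(i + p - 1) / p, ?_, ?_⟩
    · have h1 := Nat.div_add_mod (i + p - 1) p
      have h2 := Nat.mod_lt (i + p - 1) hp
      rw [Nat.mul_comm] at h1
      omega
    · have := Nat.div_mul_le_self (i + p - 1) p
      omega
  obtain ⟨a, ha, hamin⟩ := Finset.exists_min_image (Finset.Ico a₀ (a₀ + k)) (key w p)
    ⟨a₀, by simp [hk]⟩
  rw [Finset.mem_Ico] at ha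
  have hge : ∀ b, a₀ ≤ b → i ≤ b * p := fun b hb => ha₀.trans (Nat.mul_le_mul_right p hb)
  have hkey : ∀ b, a₀ ≤ b → key w p (b + k) = key w p b := by
    intro b hb
    simp only [key]
    congr 1
    funext x
    have := w1 (b * p + x) (by have := hge b hb; omega)
    rw [← this, Nat.add_mul, ← hqdef]
    congr 1
    omega
  have hall : ∀ b, a₀ ≤ b → key w p a ≤ key w p b := by
    intro b
    induction b using Nat.strong_induction_on with
    | _ b ih =>
      intro hb
      by_cases h : b < a₀ + k
      · exact hamin b (by simp; omega)
      · have h1 := ih (b - k) (by omega) (by omega)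
        have h2 := hkey (b - k) (by omega)
        rw [Nat.sub_add_cancel (by omega)] at h2
        rwa [h2]
  have hai := hge a ha.1
  have haq : a * p + q ≤ j := by
    have h1 : a * p ≤ (a₀ + k - 1) * p := Nat.mul_le_mul_right p (by omega)
    have h2 : (a₀ + k - 1) * p + p = a₀ * p + q := by
      rw [hqdef, ← Nat.add_mul, ← Nat.succ_mul]
      congr 1
      omega
    omega
  have ha1 : 1 ≤ a := by
    rcases Nat.eq_zero_or_pos a with h | h
    · rw [h] at hai; omega
    · exact h
  refine ⟨a, ha1, hai, haq, by omega, ?_, ?_⟩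
  · rw [key_lt]
    refine ⟨j + 1 - q - a * p, ?_, ?_⟩
    · intro x hx
      rw [Nat.add_mul, ← hqdef, ← hper (a * p + x) (by omega) (by omega)]
      congr 1
      omega
    · rw [Nat.add_mul, ← hqdef]
      rw [show a * p + q + (j + 1 - q - a * p) = j + 1 by omega,
        show a * p + (j + 1 - q - a * p) = j + 1 - q by omega]
      exact hlt
  · intro c hc1 hc2
    obtain ⟨d, rfl⟩ : ∃ d, c = a + d := ⟨c - a, by omega⟩
    have hd : 0 < d := by omega
    have hdk : d < k := by omega
    have hdq : d * p + (k - d) * p = q := by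
      rw [hqdef, ← Nat.add_mul]
      congr 1
      omega
    have hne : key w p a ≠ key w p (a + d) := by
      intro h
      refine hmin d hd hdk ?_
      intro y hy hyj
      have hx : ∀ x, w (a * p + x) = w ((a + d) * p + x) := fun x => congrFun h x
      have h0 : a * p ≤ y + a * q := by
        have : a * p ≤ a * q := Nat.mul_le_mul_left a (Nat.le_mul_of_pos_left p hk)
        omega
      have h1 := hx (y + a * q - a * p)
      rw [Nat.add_mul, show a * p + (y + a * q - a * p) = y + a * q by omega,
        show a * p + d * p + (y + a * q - a * p) = y + d * p + a * q by omega,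
        w3 _ _ hy, w3 _ _ (by omega), w2 y hy (by omega), w2 _ (by omega) hyj] at h1
      exact h1.symm
    have hlt' := lt_of_le_of_ne (hall (a + d) (by omega)) hne
    rw [key_lt] at hlt'
    obtain ⟨l, hl1, hl2⟩ := hlt'
    have hl : l < (k - d) * p := by
      by_contra hcon
      have hcon := not_lt.mp hcon
      refine absurd (hall (a + (k - d)) (by omega)) (not_le.mpr ?_)
      rw [← hkey a ha.1, key_lt]
      refine ⟨l - (k - d) * p, ?_, ?_⟩
      · intro x hx
        have := hl1 ((k - d) * p + x) (by omega)
        rw [Nat.add_mul] at this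
        rw [Nat.add_mul, Nat.add_mul, ← hqdef]
        convert this using 2 <;> omega
      · rw [Nat.add_mul] at hl2
        rw [Nat.add_mul, Nat.add_mul, ← hqdef]
        convert hl2 using 2 <;> omega
    apply le_of_lt
    rw [key_lt]
    rw [Nat.add_mul] at *
    refine ⟨l, ?_, ?_⟩
    · intro x hx
      rw [← w2 _ (by omega) (by omega), ← w2 _ (by omega) (by omega)]
      exact hl1 x hx
    · rw [← w2 _ (by omega) (by omega), ← w2 (a * p + d * p + l) (by omega) (by omega)]
      exact hl2

/-! ### Characterization of `p`-runs -/

theorem minPeriod_spec {α : Type} (t : ℕ → α) (i j : ℕ) (h : i ≤ j) :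
    IsPeriodOf t i j (minPeriod t i j) := by
  have : (minPeriod t i j) ∈ {p | IsPeriodOf t i j p} :=
    Nat.sInf_mem ⟨j + 1 - i, by omega, le_rfl, fun k h1 h2 => by omega⟩
  exact this

theorem minPeriod_le {α : Type} (t : ℕ → α) (i j q : ℕ) (h : IsPeriodOf t i j q) :
    minPeriod t i j ≤ q := Nat.sInf_le h

theorem minPeriod_dvd {α : Type} (t : ℕ → α) (i j q : ℕ) (h : IsPeriodOf t i j q)
    (hl : q + minPeriod t i j ≤ j + 1 - i) : minPeriod t i j ∣ q := by
  have hij : i ≤ j := by have := h.1; omega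
  have hs := minPeriod_spec t i j hij
  induction q using Nat.strong_induction_on with
  | _ q ih =>
    have hle := minPeriod_le t i j q h
    generalize minPeriod t i j = m at *
    obtain ⟨s1, s2, s3⟩ := hs
    obtain ⟨h1, h2, h3⟩ := h
    rcases Nat.eq_or_lt_of_le hle with rfl | hlt
    · exact dvd_rfl
    · have : m ∣ q - m := by
        refine ih (q - m) (by omega) ⟨by omega, by omega, fun k hk hk' => ?_⟩ (by omega)
        by_cases hc : k + q ≤ j
        · have e1 := h3 k hk hc
          have e2 := s3 (k + (q - m)) (by omega) (by omega)
          rw [show k + (q - m) + m = k + q by omega] at e2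
          rw [← e2, e1]
        · have e1 := s3 (k - m) (by omega) (by omega)
          have e2 := h3 (k - m) (by omega) (by omega)
          rw [show k - m + m = k by omega] at e1
          rw [show k - m + q = k + (q - m) by omega] at e2
          rw [e2, e1]
      exact (Nat.dvd_sub_iff_left hle dvd_rfl).mp this

theorem per_mul {α : Type} (t : ℕ → α) (i j m c : ℕ)
    (h : ∀ k, i ≤ k → k + m ≤ j → t (k + m) = t k) :
    ∀ k, i ≤ k → k + m * c ≤ j → t (k + m * c) = t k := by
  induction c with
  | zero => intros; simp
  | succ c ih =>
    intro k hk hk'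
    rw [Nat.mul_succ] at hk' ⊢
    rw [← Nat.add_assoc, h _ (by omega) (by omega), ih k hk (by omega)]

theorem maxPer_of_run {α : Type} (t : ℕ → α) (n q i j : ℕ) (hr : IsRun t n i j)
    (hl : 2 * q ≤ j + 1 - i) (hq : IsPeriodOf t i j q) : MaxPer t n q i j := by
  obtain ⟨r1, r2, r3, r4, r5, r6⟩ := hr
  have hs := minPeriod_spec t i j r2
  have hle := minPeriod_le t i j q hq
  have hd := minPeriod_dvd t i j q hq (by omega)
  generalize minPeriod t i j = m at *
  obtain ⟨c, hc⟩ := hd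
  obtain ⟨s1, s2, s3⟩ := hs
  obtain ⟨q1, q2, q3⟩ := hq
  have hc1 : 1 ≤ c := by
    rcases Nat.eq_zero_or_pos c with h | h
    · rw [h] at hc; omega
    · exact h
  have hqm : m + m * (c - 1) = q := by
    rw [hc, Nat.add_comm, ← Nat.mul_succ]
    congr 1
    omega
  have hmul := per_mul t i j m (c - 1) s3
  refine ⟨r1, r3, q3, ?_, ?_⟩
  · intro hi heq
    refine absurd (minPeriod_le t (i - 1) j m ⟨s1, by omega, fun k hk hk' => ?_⟩)
      (not_le.mpr (r5 hi))
    rcases Nat.eq_or_lt_of_le hk with rfl | hk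
    · rw [← heq, ← hqm, ← Nat.add_assoc, hmul _ (by omega) (by omega)]
    · exact s3 k (by omega) hk'
  · intro hj heq
    refine absurd (minPeriod_le t i (j + 1) m ⟨s1, by omega, fun k hk hk' => ?_⟩)
      (not_le.mpr (r6 hj))
    rcases Nat.eq_or_lt_of_le hk' with h | h
    · have := hmul (j + 1 - q) (by omega) (by omega)
      rw [h, heq, ← this]
      congr 1
      omega
    · exact s3 k hk (by omega)

theorem run_of_maxPer {α : Type} (t : ℕ → α) (n q i j : ℕ) (h1 : 1 ≤ q)
    (hl : 2 * q ≤ j + 1 - i) (h : MaxPer t n q i j) : IsRun t n i j ∧ IsPeriodOf t i j q := by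
  obtain ⟨m1, m2, m3, m4, m5⟩ := h
  have hq : IsPeriodOf t i j q := ⟨h1, by omega, m3⟩
  have hle := minPeriod_le t i j q hq
  have hd := minPeriod_dvd t i j q hq (by omega)
  refine ⟨⟨m1, by omega, m2, by omega, ?_, ?_⟩, hq⟩
  · intro hi
    by_contra hcon
    obtain ⟨s1, s2, s3⟩ := minPeriod_spec t (i - 1) j (by omega)
    have hge : minPeriod t i j ≤ minPeriod t (i - 1) j :=
      minPeriod_le _ _ _ _ ⟨s1, by omega, fun k hk hk' => s3 k (by omega) hk'⟩
    have he : minPeriod t (i - 1) j = minPeriod t i j := by omega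
    rw [he] at s3
    obtain ⟨c, hc⟩ := hd
    have := per_mul t (i - 1) j _ c s3 (i - 1) le_rfl (by rw [← hc]; omega)
    rw [← hc] at this
    exact m4 hi this
  · intro hj
    by_contra hcon
    obtain ⟨s1, s2, s3⟩ := minPeriod_spec t i (j + 1) (by omega)
    have hge : minPeriod t i j ≤ minPeriod t i (j + 1) :=
      minPeriod_le _ _ _ _ ⟨s1, by omega, fun k hk hk' => s3 k (by omega) (by omega)⟩
    have he : minPeriod t i (j + 1) = minPeriod t i j := by omega
    rw [he] at s3
    obtain ⟨c, hc⟩ := hd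
    have := per_mul t i (j + 1) _ c s3 (j + 1 - q) (by omega) (by rw [← hc]; omega)
    rw [← hc, Nat.sub_add_cancel (by omega)] at this
    exact m5 hj this

theorem maxPer_unique {α : Type} (t : ℕ → α) (n q i j i' j' A : ℕ) (h : MaxPer t n q i j)
    (h' : MaxPer t n q i' j') (h1 : i ≤ A) (h2 : A + q ≤ j + 1) (h1' : i' ≤ A)
    (h2' : A + q ≤ j' + 1) (hq : 1 ≤ q) : i ≤ i' ∧ j' ≤ j := by
  obtain ⟨m1, m2, m3, m4, m5⟩ := h
  obtain ⟨m1', m2', m3', m4', m5'⟩ := h'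
  constructor
  · by_contra hc
    exact m4 (by omega) (m3' (i - 1) (by omega) (by omega))
  · by_contra hc
    have := m3' (j + 1 - q) (by omega) (by omega)
    rw [Nat.sub_add_cancel (by omega)] at this
    exact m5 (by omega) this

theorem whole_spec {α : Type} [LinearOrder α] (t : ℕ → α) (n p : ℕ) (hp : 0 < p) (i j : ℕ) :
    IsPRun t n p i j ↔ ∃ q, (i, j, q) ∈ (whole n p).run t ∧ 2 * q ≤ j + 1 - i := by
  have hm := Nat.div_mul_le_self n p
  have hbn : ∀ b, b ≤ n / p → b * p ≤ n := fun b hb => (Nat.mul_le_mul_right p hb).trans hm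
  obtain ⟨g1, g2⟩ := loop_spec t n p (n / p) hp hm .gt (key (pad n t) p) (by
    intro a b ha hab hb
    rcases cmp_spec t n p a b hp hab (hbn b hb) with ⟨h1, h2⟩ | ⟨h1, h2⟩
    · simp [h1, h2]
    · simp [h1, h2.le]) (n / p) le_rfl [] (by simp) (by simp) (fun c h1 h2 => by omega)
  obtain ⟨l1, l2⟩ := loop_spec t n p (n / p) hp hm .lt
    (key (fun x => OrderDual.toDual (pad n t x)) p) (by
    intro a b ha hab hb
    rw [key_dual]
    rcases cmp_spec t n p a b hp hab (hbn b hb) with ⟨h1, h2⟩ | ⟨h1, h2⟩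
    · simp [h1, h2.le]
    · simp [h1, h2]) (n / p) le_rfl [] (by simp) (by simp) (fun c h1 h2 => by omega)
  simp only [whole, run_bind, run, List.mem_append]
  constructor
  · rintro ⟨hr, hex⟩
    -- the minimal multiple of `p`
    classical
    have hex' : ∃ k, 2 * (k * p) ≤ j + 1 - i ∧ IsPeriodOf t i j (k * p) := by
      obtain ⟨q, ⟨k, rfl⟩, h1, h2⟩ := hex
      exact ⟨k, by rwa [Nat.mul_comm k], by rwa [Nat.mul_comm k]⟩
    obtain ⟨hk1, hk2⟩ := Nat.find_spec hex'
    have hkmin := fun d => Nat.find_min hex' (m := d)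
    generalize Nat.find hex' = k at *
    have hM := maxPer_of_run t n (k * p) i j hr hk1 hk2
    have hq := hk2.1
    have hk : 0 < k := Nat.pos_of_mul_pos_right hq
    have hlen : i + 2 * (k * p) ≤ j + 1 := by omega
    have hM' := hM
    obtain ⟨m1, m2, m3, m4, m5⟩ := hM
    have hpad : ∀ y, y ≤ n → pad n t y = (t y : WithBot α) := fun y hy => if_pos hy
    have hper : ∀ y, i ≤ y → y + k * p ≤ j → pad n t (y + k * p) = pad n t y := by
      intro y h1 h2
      rw [hpad _ (by omega), hpad _ (by omega), m3 y h1 h2]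
    have hmin : ∀ d, 0 < d → d < k →
        ¬ ∀ y, i ≤ y → y + d * p ≤ j → pad n t (y + d * p) = pad n t y := by
      intro d hd hdk hcon
      have hdp : d * p < k * p := Nat.mul_lt_mul_of_pos_right hdk hp
      refine hkmin d hdk ⟨by omega, Nat.mul_pos hd hp, by omega, fun y h1 h2 => ?_⟩
      have := hcon y h1 h2
      rw [hpad _ (by omega), hpad _ (by omega)] at this
      exact WithBot.coe_injective this
    have hfin : ∀ a, a * p + k * p ≤ j → a + k ≤ n / p := by
      intro a h
      rw [Nat.le_div_iff_mul_le hp, Nat.add_mul]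
      omega
    have hne : pad n t (j + 1) ≠ pad n t (j + 1 - k * p) := by
      rw [hpad (j + 1 - k * p) (by omega)]
      by_cases hj : j < n
      · rw [hpad _ (by omega)]
        exact fun h => m5 hj (WithBot.coe_injective h)
      · simp only [pad]
        rw [if_neg (by omega)]
        exact WithBot.bot_ne_coe
    have close : ∀ (a i' j' : ℕ), i ≤ a * p → a * p + k * p ≤ j → i' ≤ a * p →
        a * p + (a + k - a) * p ≤ j' + 1 → MaxPer t n ((a + k - a) * p) i' j' →
        i' = i ∧ j' = j ∧ (a + k - a) * p = k * p := by
      intro a i' j' h1 h2 h3 h4 h5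
      rw [Nat.add_sub_cancel_left] at *
      have u1 := maxPer_unique t n _ i j i' j' (a * p) hM' h5 h1 (by omega) h3 h4 hq
      have u2 := maxPer_unique t n _ i' j' i j (a * p) h5 hM' h3 h4 h1 (by omega) hq
      omega
    refine ⟨k * p, ?_, hk1⟩
    rcases lt_or_gt_of_ne hne with hlt | hlt
    · obtain ⟨a, a1, a2, a3, a4⟩ := exists_nss (pad n t) p k i j hp hk m1 hlen hper hlt hmin
      obtain ⟨i', j', b1, b2, b3, b4⟩ := g2 a (a + k) a1 (by have := hfin a a3; omega)
        (hfin a a3) a4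
      obtain ⟨rfl, rfl, e⟩ := close a i' j' a2 a3 b3 b4 b2
      rw [e] at b1
      exact Or.inl b1
    · obtain ⟨a, a1, a2, a3, a4⟩ := exists_nss (fun x => OrderDual.toDual (pad n t x)) p k i j hp hk
        m1 hlen hper hlt hmin
      obtain ⟨i', j', b1, b2, b3, b4⟩ := l2 a (a + k) a1 (by have := hfin a a3; omega)
        (hfin a a3) a4
      obtain ⟨rfl, rfl, e⟩ := close a i' j' a2 a3 b3 b4 b2
      rw [e] at b1
      exact Or.inr b1
  · rintro ⟨q, hq, hl⟩
    have : MaxPer t n q i j ∧ 1 ≤ q ∧ p ∣ q := by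
      rcases hq with hq | hq
      · exact g1 _ hq
      · exact l1 _ hq
    obtain ⟨h1, h2, h3⟩ := this
    have := run_of_maxPer t n q i j h2 hl h1
    exact ⟨this.1, q, h3, hl, this.2⟩

/-- There is a constant `c` such that for all positive `n` and `p` there is a
decision tree of basic height at most `c·n/p` finding all `p`-runs in strings
of length `n`. -/
theorem p_runs_decision_tree :
    ∃ c : ℝ, 0 < c ∧ ∀ n p : ℕ, 0 < n → 0 < p →
      ∃ T : DecisionTree, T.WF n ∧ FindsAllPRuns n p T ∧
        (T.basicHeight : ℝ) ≤ c * n / p := by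
  refine ⟨8, by norm_num, fun n p _ hp => ⟨(whole n p).toTree, ?_, ?_, ?_⟩⟩
  · exact Prog.wf_toTree n _ (whole_ok n p hp)
  · intro α _ t₁ t₂ h i j
    rw [whole_spec t₁ n p hp, whole_spec t₂ n p hp, Prog.run_of_path _ t₁ t₂ h]
  · rw [Prog.basicHeight_toTree]
    have h1 : (((whole n p).bh (fun _ => 0) : ℕ) : ℝ) ≤ 8 * ((n / p : ℕ) : ℝ) := by
      exact_mod_cast whole_bh n p
    have h2 : ((n / p : ℕ) : ℝ) ≤ (n : ℝ) / p := Nat.cast_div_le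
    rw [mul_div_assoc]
    linarith
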